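/- arXiv:1705.03323 — 2 statements merged into one kernel-verified Lean document; each statement's English description precedes it below -/
import Mathlib

section
/- Let n be a natural number, let ρ : (Fin n → ℝ) → ℝ be a smooth function with ρ x > 0 for all x, and let X, Y : (Fin n → ℝ) → (Fin n → ℝ) be twice continuously differentiable vector fields. Then for every x, Div_ρ [X,Y] (x) = ∑ i, X x i * D_i (Div_ρ Y) (x) − ∑ i, Y x i * D_i (Div_ρ X) (x), where [X,Y] is the Lie bracket of vector fields, [X,Y](x) = DY(x)(X(x)) − DX(x)(Y(x)). (The divergence of a Lie bracket equals the derivative of the divergence of the second field along the first, minus the derivative of the divergence of the first field along the second.) -/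
open scoped BigOperators

/-- The divergence of a vector field `X` on `Fin n → ℝ` with respect to a positive
density `ρ`: `Div_ρ X (x) = (ρ x)⁻¹ * ∑ i, D_i (X^i ρ) (x)`. -/
noncomputable def divRho {n : ℕ} (ρ : (Fin n → ℝ) → ℝ)
    (X : (Fin n → ℝ) → (Fin n → ℝ)) (x : Fin n → ℝ) : ℝ :=
  (ρ x)⁻¹ * ∑ i, fderiv ℝ (fun y => X y i * ρ y) x (Pi.single i 1)

theorem ContinuousLinearMap.sum_mul_apply_single {n : ℕ} (A : (Fin n → ℝ) →L[ℝ] ℝ)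
    (v : Fin n → ℝ) : ∑ i, v i * A (Pi.single i 1) = A v := by
  conv_rhs => rw [← Finset.univ_sum_single v, map_sum]
  refine Finset.sum_congr rfl fun i _ => ?_
  rw [← smul_eq_mul, ← map_smul, ← Pi.single_smul, smul_eq_mul, mul_one]

/-- The trace of a product of two endomorphisms does not depend on their order. -/
theorem ContinuousLinearMap.sum_apply_apply_single_comm {n : ℕ}
    (A B : (Fin n → ℝ) →L[ℝ] (Fin n → ℝ)) :
    ∑ i, A (B (Pi.single i 1)) i = ∑ i, B (A (Pi.single i 1)) i := by
  have expand (C : (Fin n → ℝ) →L[ℝ] (Fin n → ℝ)) (v : Fin n → ℝ) (i : Fin n) :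
      C v i = ∑ j, v j * C (Pi.single j 1) i :=
    (((ContinuousLinearMap.proj i).comp C).sum_mul_apply_single v).symm
  simp_rw [expand A (B _), expand B (A _)]
  rw [Finset.sum_comm]
  simp_rw [mul_comm]

/-- The divergence with respect to `ρ` is the Euclidean divergence plus the derivative of `log ρ`
along the field. -/
theorem divRho_eq_sum_add_fderiv_log {n : ℕ} {ρ : (Fin n → ℝ) → ℝ}
    {X : (Fin n → ℝ) → (Fin n → ℝ)} {x : Fin n → ℝ} (hρ : DifferentiableAt ℝ ρ x)
    (hx : ρ x ≠ 0) (hX : DifferentiableAt ℝ X x) :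
    divRho ρ X x =
      ∑ i, fderiv ℝ X x (Pi.single i 1) i + fderiv ℝ (fun y => Real.log (ρ y)) x (X x) := by
  have hcoord (i : Fin n) : HasFDerivAt (fun y => X y i)
      ((ContinuousLinearMap.proj i).comp (fderiv ℝ X x)) x :=
    hasFDerivAt_pi'.1 hX.hasFDerivAt i
  rw [divRho, ← ContinuousLinearMap.sum_mul_apply_single, (hρ.hasFDerivAt.log hx).fderiv,
    Finset.mul_sum, ← Finset.sum_add_distrib]
  refine Finset.sum_congr rfl fun i _ => ?_
  rw [((hcoord i).fun_mul hρ.hasFDerivAt).fderiv]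
  simp only [add_apply, smul_apply, smul_eq_mul,
    ContinuousLinearMap.comp_apply, ContinuousLinearMap.proj_apply]
  field_simp
  ring

theorem fderiv_divRho_apply {n : ℕ} {ρ : (Fin n → ℝ) → ℝ} {X : (Fin n → ℝ) → (Fin n → ℝ)}
    (hρ : ContDiff ℝ 2 ρ) (hρ0 : ∀ x, ρ x ≠ 0) (hX : ContDiff ℝ 2 X) (x w : Fin n → ℝ) :
    fderiv ℝ (divRho ρ X) x w =
      ∑ i, fderiv ℝ (fderiv ℝ X) x w (Pi.single i 1) i +
        (fderiv ℝ (fderiv ℝ fun y => Real.log (ρ y)) x w (X x) +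
          fderiv ℝ (fun y => Real.log (ρ y)) x (fderiv ℝ X x w)) := by
  have hdiff : Differentiable ℝ X := hX.differentiable (by norm_num)
  have hDX : DifferentiableAt ℝ (fderiv ℝ X) x :=
    (hX.fderiv_right (m := 1) (by norm_num)).differentiable (by norm_num) x
  have hDlog : DifferentiableAt ℝ (fderiv ℝ fun y => Real.log (ρ y)) x :=
    ((hρ.log hρ0).fderiv_right (m := 1) (by norm_num)).differentiable (by norm_num) x
  have hcoord (i : Fin n) := hasFDerivAt_pi'.1
    (hDX.hasFDerivAt.clm_apply (hasFDerivAt_const (Pi.single i (1 : ℝ)) x)) i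
  have hdiv := (HasFDerivAt.fun_sum (u := Finset.univ) fun i _ => hcoord i).add
    (hDlog.hasFDerivAt.clm_apply (hdiff x).hasFDerivAt)
  have heq : divRho ρ X = fun y => ∑ i, fderiv ℝ X y (Pi.single i 1) i +
      fderiv ℝ (fun y => Real.log (ρ y)) y (X y) := funext fun y =>
    divRho_eq_sum_add_fderiv_log (hρ.differentiable (by norm_num) y) (hρ0 y) (hdiff y)
  rw [heq]
  refine (DFunLike.congr_fun hdiv.fderiv w).trans ?_
  simp [add_comm]

/-- The divergence of a Lie bracket of vector fields:
`Div_ρ [X,Y] = X(Div_ρ Y) − Y(Div_ρ X)`. -/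
theorem divRho_lieBracket {n : ℕ} (ρ : (Fin n → ℝ) → ℝ)
    (hρ : ContDiff ℝ (⊤ : ℕ∞) ρ) (hρpos : ∀ x, 0 < ρ x)
    (X Y : (Fin n → ℝ) → (Fin n → ℝ))
    (hX : ContDiff ℝ 2 X) (hY : ContDiff ℝ 2 Y) (x : Fin n → ℝ) :
    divRho ρ (VectorField.lieBracket ℝ X Y) x =
      ∑ i, X x i * fderiv ℝ (divRho ρ Y) x (Pi.single i 1) -
      ∑ i, Y x i * fderiv ℝ (divRho ρ X) x (Pi.single i 1) := by
  have hρ2 : ContDiff ℝ 2 ρ := contDiff_infty.1 hρ 2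
  have hρ0 (y) : ρ y ≠ 0 := (hρpos y).ne'
  have hdX : DifferentiableAt ℝ X x := hX.differentiable (by norm_num) x
  have hdY : DifferentiableAt ℝ Y x := hY.differentiable (by norm_num) x
  have hDX : DifferentiableAt ℝ (fderiv ℝ X) x :=
    (hX.fderiv_right (m := 1) (by norm_num)).differentiable (by norm_num) x
  have hDY : DifferentiableAt ℝ (fderiv ℝ Y) x :=
    (hY.fderiv_right (m := 1) (by norm_num)).differentiable (by norm_num) x
  have symmX : IsSymmSndFDerivAt ℝ X x := hX.contDiffAt.isSymmSndFDerivAt (by simp)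
  have symmY : IsSymmSndFDerivAt ℝ Y x := hY.contDiffAt.isSymmSndFDerivAt (by simp)
  have symmLog : IsSymmSndFDerivAt ℝ (fun y => Real.log (ρ y)) x :=
    (hρ2.log hρ0).contDiffAt.isSymmSndFDerivAt (by simp)
  have hbracket : HasFDerivAt (VectorField.lieBracket ℝ X Y) _ x :=
    (hDY.hasFDerivAt.clm_apply hdX.hasFDerivAt).sub (hDX.hasFDerivAt.clm_apply hdY.hasFDerivAt)
  rw [ContinuousLinearMap.sum_mul_apply_single, ContinuousLinearMap.sum_mul_apply_single,
    fderiv_divRho_apply hρ2 hρ0 hY, fderiv_divRho_apply hρ2 hρ0 hX,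
    divRho_eq_sum_add_fderiv_log (hρ2.differentiable (by norm_num) x) (hρ0 x)
      hbracket.differentiableAt, hbracket.fderiv, symmLog.eq (Y x) (X x)]
  simp only [VectorField.lieBracket, sub_apply, add_apply,
    ContinuousLinearMap.comp_apply, ContinuousLinearMap.flip_apply, Pi.sub_apply, Pi.add_apply,
    Finset.sum_sub_distrib, Finset.sum_add_distrib, map_sub, symmX.eq _ (Y x), symmY.eq _ (X x)]
  rw [ContinuousLinearMap.sum_apply_apply_single_comm (fderiv ℝ Y x)]
  ring
end

section
/- Let n be a natural number, let ρ : (Fin n → ℝ) → ℝ be a smooth function with ρ x > 0 for all x, let X : (Fin n → ℝ) → (Fin n → ℝ) be a continuously differentiable vector field with compact support, and let f : (Fin n → ℝ) → ℝ be continuously differentiable. Then ∫ (f x * Div_ρ X (x) + ∑ i, X x i * D_i f (x)) * ρ x dλ(x) = 0, where λ is Lebesgue measure on Fin n → ℝ. Equivalently, integration against the density ρ intertwines Div_ρ acting on compactly supported vector fields with minus the derivative along X acting on functions: ⟨f · Div_ρ X, ρ⟩ = −⟨X(f), ρ⟩. (The classical case of Poincaré duality between the standard cochain and chain complexes of a unimodular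 Q-manifold, obtained from invariance of integration.) -/
open scoped BigOperators
open MeasureTheory

theorem HasCompactSupport.integrable_mul_fderiv_and_fderiv_mul
    {E : Type*} [NormedAddCommGroup E] [NormedSpace ℝ E] [MeasurableSpace E] [BorelSpace E]
    {μ : Measure E} [IsFiniteMeasureOnCompacts μ] {f h : E → ℝ}
    (hh : HasCompactSupport h) (hf : ContDiff ℝ 1 f) (hh' : ContDiff ℝ 1 h) (v : E) :
    Integrable (fun x => f x * fderiv ℝ h x v) μ ∧
      Integrable (fun x => fderiv ℝ f x v * h x) μ := by
  have hf_cont : Continuous fun x => fderiv ℝ f x v :=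
    (hf.continuous_fderiv one_ne_zero).clm_apply continuous_const
  have hh_cont : Continuous fun x => fderiv ℝ h x v :=
    (hh'.continuous_fderiv one_ne_zero).clm_apply continuous_const
  exact ⟨(hf.continuous.mul hh_cont).integrable_of_hasCompactSupport
      (HasCompactSupport.mul_left (hh.fderiv_apply ℝ v)),
    (hf_cont.mul hh'.continuous).integrable_of_hasCompactSupport
      (HasCompactSupport.mul_left hh)⟩

theorem HasCompactSupport.integral_mul_fderiv_add_fderiv_mul
    {E : Type*} [NormedAddCommGroup E] [NormedSpace ℝ E] [FiniteDimensional ℝ E]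
    [MeasurableSpace E] [BorelSpace E] {μ : Measure E} [μ.IsAddHaarMeasure] {f h : E → ℝ}
    (hh : HasCompactSupport h) (hf : ContDiff ℝ 1 f) (hh' : ContDiff ℝ 1 h) (v : E) :
    ∫ x, (f x * fderiv ℝ h x v + fderiv ℝ f x v * h x) ∂μ = 0 := by
  obtain ⟨h₁, h₂⟩ := hh.integrable_mul_fderiv_and_fderiv_mul (μ := μ) hf hh' v
  rw [integral_add h₁ h₂, integral_mul_fderiv_eq_neg_fderiv_mul_of_integrable h₂ h₁
    ((hf.continuous.mul hh'.continuous).integrable_of_hasCompactSupport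
      (HasCompactSupport.mul_left hh))
    (fun x _ => hf.differentiable one_ne_zero x)
    (fun x _ => hh'.differentiable one_ne_zero x), neg_add_cancel]

/-- Poincaré duality / invariance of integration: for a compactly supported `C¹`
vector field `X` and a `C¹` function `f`,
`∫ (f · Div_ρ X + X(f)) ρ dλ = 0`, i.e. `⟨f · Div_ρ X, ρ⟩ = −⟨X(f), ρ⟩`. -/
theorem integral_divRho_pairing {n : ℕ} (ρ : (Fin n → ℝ) → ℝ)
    (hρ : ContDiff ℝ (⊤ : ℕ∞) ρ) (hρpos : ∀ x, 0 < ρ x)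
    (X : (Fin n → ℝ) → (Fin n → ℝ)) (hX : ContDiff ℝ 1 X)
    (hXsupp : HasCompactSupport X)
    (f : (Fin n → ℝ) → ℝ) (hf : ContDiff ℝ 1 f) :
    ∫ x, (f x * divRho ρ X x + ∑ i, X x i * fderiv ℝ f x (Pi.single i 1)) * ρ x
      ∂(volume : Measure (Fin n → ℝ)) = 0 := by
  have hsupp (i : Fin n) : HasCompactSupport fun y => X y i * ρ y :=
    HasCompactSupport.mul_right (hXsupp.comp_left (g := fun z : Fin n → ℝ => z i) rfl)
  have hdiff (i : Fin n) : ContDiff ℝ 1 fun y => X y i * ρ y :=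
    (contDiff_pi.mp hX i).mul (hρ.of_le (by exact_mod_cast le_top))
  have hint (i : Fin n) :=
    (hsupp i).integrable_mul_fderiv_and_fderiv_mul (μ := volume) hf (hdiff i) (Pi.single i 1)
  calc
    _ = ∫ x, ∑ i, (f x * fderiv ℝ (fun y => X y i * ρ y) x (Pi.single i 1) +
          fderiv ℝ f x (Pi.single i 1) * (X x i * ρ x)) := by
      refine integral_congr_ae (.of_forall fun x => ?_)
      have hx := (hρpos x).ne'
      simp only [divRho, Finset.sum_add_distrib, ← Finset.mul_sum, add_mul, Finset.sum_mul]
      congr 1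
      · field_simp
      · exact Finset.sum_congr rfl fun i _ => by ring
    _ = 0 := by
      refine (integral_finsetSum _ fun i _ => (hint i).1.add (hint i).2).trans ?_
      exact Finset.sum_eq_zero fun i _ =>
        (hsupp i).integral_mul_fderiv_add_fderiv_mul hf (hdiff i) _
end
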